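/- arXiv:2503.14175 — 4 statements merged into one kernel-verified Lean document; each statement's English description precedes it below -/
import Mathlib

section
/- In the ring of formal power series ℤ⟦q⟧ one has the identity (1 − q)(1 − q²) · FZ₂(q) = (2 − q) · Z(q). -/
open PowerSeries

/-- The number of Young diagrams (partitions) of size `n`. -/
noncomputable def partitionCount (n : ℕ) : ℕ :=
  Nat.card {μ : YoungDiagram // μ.card = n}

/-- `Z(q)`, the generating series of partition numbers. -/
noncomputable def Zq : PowerSeries ℤ :=
  PowerSeries.mk fun n => (partitionCount n : ℤ)

/-- The number of pairs `(μ, ν)` of Young diagrams with `μ ⊆ ν`, `|μ| = n`, `|ν| = n + D`. -/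
noncomputable def nestedPairCount (D n : ℕ) : ℕ :=
  Nat.card {p : YoungDiagram × YoungDiagram //
    p.1 ≤ p.2 ∧ p.1.card = n ∧ p.2.card = n + D}

/-- `FZ_D(q)`, the generating series of `nestedPairCount D`. -/
noncomputable def FZ (D : ℕ) : PowerSeries ℤ :=
  PowerSeries.mk fun n => (nestedPairCount D n : ℤ)

namespace YoungDiagram

/-- The row lengths of a Young diagram, as a finitely supported function. -/
noncomputable def rowFinsupp (μ : YoungDiagram) : ℕ →₀ ℕ :=
  Finsupp.onFinset (Finset.range (μ.colLen 0)) μ.rowLen fun i hi => by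
    rw [Finset.mem_range, ← mem_iff_lt_colLen, mem_iff_lt_rowLen]
    omega

@[simp]
theorem rowFinsupp_apply (μ : YoungDiagram) (i : ℕ) : μ.rowFinsupp i = μ.rowLen i := rfl

theorem rowFinsupp_le_iff {μ ν : YoungDiagram} : μ.rowFinsupp ≤ ν.rowFinsupp ↔ μ ≤ ν := by
  constructor
  · rintro h ⟨i, j⟩ hc
    have := h i
    simp only [rowFinsupp_apply] at this
    change (i, j) ∈ μ at hc
    change (i, j) ∈ ν
    rw [mem_iff_lt_rowLen] at *
    omega
  · intro h i
    simp only [rowFinsupp_apply]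
    by_contra! hlt
    have := h (mem_iff_lt_rowLen.2 hlt)
    exact lt_irrefl _ (mem_iff_lt_rowLen.1 this)

theorem rowFinsupp_injective : Function.Injective rowFinsupp := fun _ _ h =>
  le_antisymm (rowFinsupp_le_iff.1 h.le) (rowFinsupp_le_iff.1 h.ge)

theorem antitone_rowFinsupp (μ : YoungDiagram) : Antitone μ.rowFinsupp :=
  fun i j h => μ.rowLen_anti i j h

theorem degree_rowFinsupp (μ : YoungDiagram) : μ.rowFinsupp.degree = μ.card := by
  rw [YoungDiagram.card, Finset.card_eq_sum_card_fiberwise (f := Prod.fst)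
    (t := Finset.range (μ.colLen 0)), Finsupp.degree_apply,
    Finset.sum_subset (s₂ := Finset.range (μ.colLen 0))]
  · refine Finset.sum_congr rfl fun i _ => ?_
    rw [rowFinsupp_apply, rowLen_eq_card]
    rfl
  · exact Finsupp.support_onFinset_subset
  · exact fun i _ hi => Finsupp.notMem_support_iff.1 hi
  · rintro ⟨i, j⟩ hc
    have h := μ.up_left_mem le_rfl (Nat.zero_le j) hc
    simpa [mem_iff_lt_colLen] using h

theorem exists_rowFinsupp_eq {f : ℕ →₀ ℕ} (hf : Antitone f) : ∃ μ, rowFinsupp μ = f := by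
  let μ : YoungDiagram :=
    { cells := (f.support ×ˢ Finset.range (f 0)).filter fun c => c.2 < f c.1
      isLowerSet := by
        rintro ⟨i, j⟩ ⟨i', j'⟩ ⟨hi, hj⟩ h
        have h1 := hf hi
        have h2 := hf (Nat.zero_le i')
        simp at h h1 h2 hi hj ⊢
        omega }
  refine ⟨μ, Finsupp.ext fun i => eq_of_forall_lt_iff fun j => ?_⟩
  rw [rowFinsupp_apply, ← mem_iff_lt_rowLen, ← mem_cells]
  have := hf (Nat.zero_le i)
  simp [μ]
  omega

end YoungDiagram

/-- Antitone finitely supported functions of total degree `n`, that is, partitions of `n`. -/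
def antitoneOfDegree (n : ℕ) : Set (ℕ →₀ ℕ) := {f | Antitone f ∧ f.degree = n}

theorem lt_of_apply_pos {n : ℕ} {f : ℕ →₀ ℕ} (hf : f ∈ antitoneOfDegree n) {i : ℕ}
    (hi : 0 < f i) : i < n := by
  obtain ⟨hf, rfl⟩ := hf
  have hsub : Finset.range (i + 1) ⊆ f.support := fun j hj => by
    have := hf (Finset.mem_range_succ_iff.1 hj)
    rw [Finsupp.mem_support_iff]
    omega
  have h1 := Finset.card_nsmul_le_sum f.support f 1 fun j hj =>
    Nat.one_le_iff_ne_zero.2 (Finsupp.mem_support_iff.1 hj)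
  have h2 := Finset.card_le_card hsub
  rw [← Finsupp.degree_apply] at h1
  simp at h1 h2
  omega

theorem finite_antitoneOfDegree (n : ℕ) : (antitoneOfDegree n).Finite := by
  refine (Set.finite_Iic (∑ i ∈ Finset.range n, Finsupp.single i n)).subset ?_
  intro f hf i
  have hle := Finsupp.le_degree i f
  rw [hf.2] at hle
  have hlt := @lt_of_apply_pos n f hf i
  simp only [Finsupp.coe_finsetSum, Finset.sum_apply, Finsupp.single_apply,
    Finset.sum_ite_eq', Finset.mem_range]
  split_ifs <;> omega

theorem partitionCount_eq_ncard (n : ℕ) : partitionCount n = (antitoneOfDegree n).ncard := by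
  have : antitoneOfDegree n = YoungDiagram.rowFinsupp '' {μ | μ.card = n} := by
    ext f
    constructor
    · rintro ⟨hf, hn⟩
      obtain ⟨μ, rfl⟩ := YoungDiagram.exists_rowFinsupp_eq hf
      exact ⟨μ, by simpa [YoungDiagram.degree_rowFinsupp] using hn, rfl⟩
    · rintro ⟨μ, hμ, rfl⟩
      exact ⟨μ.antitone_rowFinsupp, by rw [μ.degree_rowFinsupp, hμ]⟩
  rw [this, Set.ncard_image_of_injective _ YoungDiagram.rowFinsupp_injective]
  rfl

theorem nestedPairCount_eq_ncard (D n : ℕ) : nestedPairCount D n =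
    {p : (ℕ →₀ ℕ) × (ℕ →₀ ℕ) | p.1 ∈ antitoneOfDegree n ∧ p.2 ∈ antitoneOfDegree (n + D) ∧
      p.1 ≤ p.2}.ncard := by
  have : {p : (ℕ →₀ ℕ) × (ℕ →₀ ℕ) | p.1 ∈ antitoneOfDegree n ∧
      p.2 ∈ antitoneOfDegree (n + D) ∧ p.1 ≤ p.2} =
      Prod.map YoungDiagram.rowFinsupp YoungDiagram.rowFinsupp ''
        {p | p.1 ≤ p.2 ∧ p.1.card = n ∧ p.2.card = n + D} := by
    ext ⟨f, g⟩
    constructor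
    · rintro ⟨⟨hf, hn⟩, ⟨hg, hm⟩, hle⟩
      obtain ⟨μ, rfl⟩ := YoungDiagram.exists_rowFinsupp_eq hf
      obtain ⟨ν, rfl⟩ := YoungDiagram.exists_rowFinsupp_eq hg
      rw [YoungDiagram.degree_rowFinsupp] at hn hm
      exact ⟨(μ, ν), ⟨YoungDiagram.rowFinsupp_le_iff.1 hle, hn, hm⟩, rfl⟩
    · rintro ⟨⟨μ, ν⟩, ⟨hle, hn, hm⟩, h⟩
      cases h
      exact ⟨⟨μ.antitone_rowFinsupp, by rw [μ.degree_rowFinsupp, hn]⟩,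
        ⟨ν.antitone_rowFinsupp, by rw [ν.degree_rowFinsupp, hm]⟩,
        YoungDiagram.rowFinsupp_le_iff.2 hle⟩
  rw [this, Set.ncard_image_of_injective _
    (YoungDiagram.rowFinsupp_injective.prodMap YoungDiagram.rowFinsupp_injective)]
  rfl

open Finsupp in
theorem exists_eq_single_add_single_of_degree_eq_two {d : ℕ →₀ ℕ} (h : d.degree = 2) :
    ∃ a b, a ≤ b ∧ d = single a 1 + single b 1 := by
  have hpos : ∀ e : ℕ →₀ ℕ, e.degree ≠ 0 → ∃ a e', e = single a 1 + e' := fun e he => by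
    have : e ≠ 0 := by rintro rfl; simp at he
    obtain ⟨a, ha⟩ := Finsupp.ne_iff.1 this
    refine ⟨a, e - single a 1, (add_tsub_cancel_of_le ?_).symm⟩
    rw [single_le_iff]
    exact Nat.one_le_iff_ne_zero.2 ha
  obtain ⟨a, e, rfl⟩ := hpos d (by omega)
  rw [map_add, degree_single] at h
  obtain ⟨b, e', rfl⟩ := hpos e (by omega)
  rw [map_add, degree_single] at h
  have : e' = 0 := (degree_eq_zero_iff e').1 (by omega)
  subst this
  rcases le_total a b with hab | hab
  · exact ⟨a, b, hab, by simp⟩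
  · exact ⟨b, a, hab, by simp [add_comm]⟩

open Finsupp in
theorem single_add_single_inj {a b a' b' : ℕ} (hab : a ≤ b) (hab' : a' ≤ b')
    (h : (single a 1 + single b 1 : ℕ →₀ ℕ) = single a' 1 + single b' 1) : a = a' ∧ b = b' := by
  have h1 := DFunLike.congr_fun h a
  have h2 := DFunLike.congr_fun h b
  have h3 := DFunLike.congr_fun h a'
  have h4 := DFunLike.congr_fun h b'
  simp only [Finsupp.add_apply, single_apply] at h1 h2 h3 h4
  grind

/-- Adding a box to row `a` and a box to row `b` of `f` is possible. -/
def TwoAddable (f : ℕ →₀ ℕ) (a b : ℕ) : Prop :=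
  (a = b ∧ (a = 0 ∨ f a + 2 ≤ f (a - 1))) ∨ (b = a + 1 ∧ (a = 0 ∨ f a < f (a - 1))) ∨
    (a + 1 < b ∧ (a = 0 ∨ f a < f (a - 1)) ∧ f b < f (b - 1))

/-- Removing a box from row `a` and a box from row `b` of `f` is possible. -/
def TwoRemovable (f : ℕ →₀ ℕ) (a b : ℕ) : Prop :=
  (a = b ∧ f (a + 1) + 2 ≤ f a) ∨ (b = a + 1 ∧ f (b + 1) < f b) ∨
    (a + 1 < b ∧ f (a + 1) < f a ∧ f (b + 1) < f b)

theorem twoAddable_iff {f : ℕ →₀ ℕ} (hf : Antitone f) {a b : ℕ} : TwoAddable f a b ↔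
    a ≤ b ∧ Antitone (f + Finsupp.single a 1 + Finsupp.single b 1 : ℕ →₀ ℕ) := by
  have hs : ∀ i, f (i + 1) ≤ f i := fun i => hf i.le_succ
  unfold TwoAddable
  constructor
  · intro h
    refine ⟨by omega, antitone_nat_of_succ_le fun i => ?_⟩
    have := hs i
    simp only [Finsupp.add_apply, Finsupp.single_apply]
    grind
  · rintro ⟨hab, h⟩
    have ha := @h (a - 1) a (by omega)
    have hb := @h (b - 1) b (by omega)
    simp only [Finsupp.add_apply, Finsupp.single_apply] at ha hb
    grind

theorem twoRemovable_iff {f : ℕ →₀ ℕ} (hf : Antitone f) {a b : ℕ} : TwoRemovable f a b ↔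
    a ≤ b ∧ ∃ h : ℕ →₀ ℕ, Antitone h ∧ f = h + Finsupp.single a 1 + Finsupp.single b 1 := by
  have hs : ∀ i, f (i + 1) ≤ f i := fun i => hf i.le_succ
  unfold TwoRemovable
  constructor
  · intro h
    refine ⟨by omega, f - (Finsupp.single a 1 + Finsupp.single b 1),
      antitone_nat_of_succ_le fun i => ?_, ?_⟩
    · have := hs i
      simp only [Finsupp.coe_tsub, Pi.sub_apply, Finsupp.add_apply, Finsupp.single_apply]
      grind
    · rw [add_assoc, tsub_add_cancel_of_le]
      intro i
      have := hs i
      simp only [Finsupp.add_apply, Finsupp.single_apply]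
      grind
  · rintro ⟨hab, h, hh, rfl⟩
    have hs' : ∀ i, h (i + 1) ≤ h i := fun i => hh i.le_succ
    have ha := hs' a
    have hb := hs' b
    simp only [Finsupp.add_apply, Finsupp.single_apply]
    grind

/-- Partitions of `n` with a row from which a box can be removed. -/
def removableRows (n : ℕ) : Set ((ℕ →₀ ℕ) × ℕ) :=
  {p | p.1 ∈ antitoneOfDegree n ∧ p.1 (p.2 + 1) < p.1 p.2}

/-- Partitions of `n` with two rows to which a box can be added. -/
def twoAddableRows (n : ℕ) : Set ((ℕ →₀ ℕ) × ℕ × ℕ) :=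
  {p | p.1 ∈ antitoneOfDegree n ∧ TwoAddable p.1 p.2.1 p.2.2}

/-- Partitions of `n` with two rows from which a box can be removed. -/
def twoRemovableRows (n : ℕ) : Set ((ℕ →₀ ℕ) × ℕ × ℕ) :=
  {p | p.1 ∈ antitoneOfDegree n ∧ TwoRemovable p.1 p.2.1 p.2.2}

theorem finite_removableRows (n : ℕ) : (removableRows n).Finite :=
  ((finite_antitoneOfDegree n).prod (Set.finite_Iio n)).subset fun _ ⟨hf, h⟩ =>
    ⟨hf, lt_of_apply_pos hf (Nat.zero_lt_of_lt h)⟩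

theorem finite_twoRemovableRows (n : ℕ) : (twoRemovableRows n).Finite :=
  ((finite_antitoneOfDegree n).prod ((Set.finite_Iio n).prod (Set.finite_Iio n))).subset
    fun ⟨f, a, b⟩ ⟨hf, h⟩ => by
      have hb : 0 < f b := by
        simp only [TwoRemovable] at h
        grind
      have h1 := lt_of_apply_pos hf hb
      have h2 : a ≤ b := ((twoRemovable_iff hf.1).1 h).1
      exact ⟨hf, h2.trans_lt h1, h1⟩

theorem nestedPairCount_two_eq_ncard_twoAddableRows (n : ℕ) :
    nestedPairCount 2 n = (twoAddableRows n).ncard := by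
  rw [nestedPairCount_eq_ncard, ← Set.InjOn.ncard_image (s := twoAddableRows n)
    (f := fun p => (p.1, p.1 + Finsupp.single p.2.1 1 + Finsupp.single p.2.2 1))]
  · congr 1
    ext ⟨f, g⟩
    constructor
    · rintro ⟨hf, hg, hle⟩
      dsimp only at hf hg hle
      obtain ⟨d, rfl⟩ := exists_add_of_le hle
      have hd : d.degree = 2 := by
        have := hg.2
        have := hf.2
        simp only [map_add] at *
        omega
      obtain ⟨a, b, hab, rfl⟩ := exists_eq_single_add_single_of_degree_eq_two hd
      refine ⟨(f, a, b), ⟨hf, (twoAddable_iff hf.1).2 ⟨hab, ?_⟩⟩, ?_⟩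
      · have := hg.1
        rwa [← add_assoc] at this
      · simp [add_assoc]
    · rintro ⟨⟨f, a, b⟩, ⟨hf, h⟩, he⟩
      cases he
      refine ⟨hf, ⟨((twoAddable_iff hf.1).1 h).2, ?_⟩, ?_⟩
      · simp [hf.2, add_assoc]
      · simp [add_assoc]
  · rintro ⟨f, a, b⟩ ⟨hf, h⟩ ⟨f', a', b'⟩ ⟨hf', h'⟩ he
    simp only [Prod.mk.injEq] at he
    obtain ⟨rfl, he⟩ := he
    rw [add_assoc, add_assoc, add_right_inj] at he
    obtain ⟨rfl, rfl⟩ := single_add_single_inj ((twoAddable_iff hf.1).1 h).1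
      ((twoAddable_iff hf.1).1 h').1 he
    rfl

theorem nestedPairCount_two_eq_ncard_twoRemovableRows (n : ℕ) :
    nestedPairCount 2 n = (twoRemovableRows (n + 2)).ncard := by
  rw [nestedPairCount_eq_ncard, ← Set.InjOn.ncard_image (s := twoRemovableRows (n + 2))
    (f := fun p => (p.1 - (Finsupp.single p.2.1 1 + Finsupp.single p.2.2 1), p.1))]
  · congr 1
    ext ⟨f, g⟩
    constructor
    · rintro ⟨hf, hg, hle⟩
      dsimp only at hf hg hle
      obtain ⟨d, rfl⟩ := exists_add_of_le hle
      have hd : d.degree = 2 := by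
        have := hg.2
        have := hf.2
        simp only [map_add] at *
        omega
      obtain ⟨a, b, hab, rfl⟩ := exists_eq_single_add_single_of_degree_eq_two hd
      exact ⟨(f + (Finsupp.single a 1 + Finsupp.single b 1), a, b),
        ⟨hg, (twoRemovable_iff hg.1).2 ⟨hab, f, hf.1, (add_assoc _ _ _).symm⟩⟩, by simp⟩
    · rintro ⟨⟨f, a, b⟩, ⟨hf, h⟩, he⟩
      obtain ⟨hab, g, hg, hfg⟩ := (twoRemovable_iff hf.1).1 h
      have hfg' : f = g + (Finsupp.single a 1 + Finsupp.single b 1) := by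
        rw [← add_assoc]; exact hfg
      cases he
      dsimp only at *
      have hsub : f - (Finsupp.single a 1 + Finsupp.single b 1) = g := by
        rw [hfg', add_tsub_cancel_right]
      refine ⟨?_, hf, tsub_le_self⟩
      dsimp only
      rw [hsub]
      refine ⟨hg, ?_⟩
      have := hf.2
      rw [hfg'] at this
      simp only [map_add, Finsupp.degree_single] at this
      omega
  · rintro ⟨f, a, b⟩ ⟨hf, h⟩ ⟨f', a', b'⟩ ⟨hf', h'⟩ he
    simp only [Prod.mk.injEq] at he
    obtain ⟨he, rfl⟩ := he
    obtain ⟨hab, g, -, hg⟩ := (twoRemovable_iff hf.1).1 h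
    obtain ⟨hab', g', -, hg'⟩ := (twoRemovable_iff hf.1).1 h'
    dsimp only at *
    rw [add_assoc] at hg hg'
    have h1 : f - (Finsupp.single a 1 + Finsupp.single b 1) = g := by
      rw [hg, add_tsub_cancel_right]
    have h2 : f - (Finsupp.single a' 1 + Finsupp.single b' 1) = g' := by
      rw [hg', add_tsub_cancel_right]
    obtain rfl : g = g' := by rw [← h1, ← h2, he]
    obtain ⟨rfl, rfl⟩ := single_add_single_inj hab hab' (add_left_cancel (hg.symm.trans hg'))
    rfl

theorem ncard_removableRows_succ (n : ℕ) : (removableRows (n + 1)).ncard =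
    (antitoneOfDegree n).ncard + (removableRows n).ncard := by
  have hu : removableRows (n + 1) =
      (fun f => (f + Finsupp.single 0 1, 0)) '' antitoneOfDegree n ∪
        (fun p => (p.1 + Finsupp.single (p.2 + 1) 1, p.2 + 1)) '' removableRows n := by
    ext ⟨g, a⟩
    constructor
    · rintro ⟨⟨hg, hn⟩, ha⟩
      dsimp only at hg hn ha
      obtain ⟨f, rfl⟩ : ∃ f, g = f + Finsupp.single a 1 :=
        ⟨g - Finsupp.single a 1, (tsub_add_cancel_of_le
          (Finsupp.single_le_iff.2 (Nat.one_le_of_lt ha))).symm⟩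
      have hs : ∀ i, _ := fun i => hg (Nat.le_succ i)
      have hf : Antitone f := antitone_nat_of_succ_le fun i => by
        have := hs i
        simp only [Finsupp.add_apply, Finsupp.single_apply] at this ha
        grind
      have hfn : f.degree = n := by simpa using hn
      cases a with
      | zero => exact Or.inl ⟨f, ⟨hf, hfn⟩, rfl⟩
      | succ a =>
        refine Or.inr ⟨(f, a), ⟨⟨hf, hfn⟩, ?_⟩, rfl⟩
        have := hs a
        simp only [Finsupp.add_apply, Finsupp.single_apply] at this ⊢
        grind
    · rintro (⟨f, ⟨hf, hn⟩, he⟩ | ⟨⟨f, a⟩, ⟨⟨hf, hn⟩, ha⟩, he⟩) <;> cases he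
      · have hs : ∀ i, _ := fun i => hf (Nat.le_succ i)
        refine ⟨⟨antitone_nat_of_succ_le fun i => ?_, by simp [hn]⟩, ?_⟩
        · have := hs i
          simp only [Finsupp.add_apply, Finsupp.single_apply]
          grind
        · have := hs 0
          simp only [Finsupp.add_apply, Finsupp.single_apply]
          grind
      · dsimp only at hf hn ha
        have hs : ∀ i, _ := fun i => hf (Nat.le_succ i)
        refine ⟨⟨antitone_nat_of_succ_le fun i => ?_, by simp [hn]⟩, ?_⟩
        · have := hs i
          simp only [Finsupp.add_apply, Finsupp.single_apply]
          grind
        · have := hs (a + 1)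
          simp only [Finsupp.add_apply, Finsupp.single_apply]
          grind
  rw [hu, Set.ncard_union_eq _ ((finite_antitoneOfDegree n).image _)
    ((finite_removableRows n).image _), Set.InjOn.ncard_image, Set.InjOn.ncard_image]
  · rintro ⟨f, a⟩ - ⟨f', a'⟩ - h
    simp only [Prod.mk.injEq, add_left_inj] at h
    obtain ⟨h, rfl⟩ := h
    rw [add_left_inj] at h
    rw [h]
  · intro f _ f' _ h
    simpa using h
  · rw [Set.disjoint_left]
    rintro _ ⟨f, -, rfl⟩ ⟨⟨f', a⟩, -, h⟩
    simp at h

theorem removableRows_zero : removableRows 0 = ∅ := by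
  ext ⟨f, a⟩
  refine iff_of_false ?_ (Set.notMem_empty _)
  rintro ⟨hf, h⟩
  exact absurd (lt_of_apply_pos hf (Nat.zero_lt_of_lt h)) (Nat.not_lt_zero _)

theorem twoRemovableRows_eq_empty {n : ℕ} (hn : n < 2) : twoRemovableRows n = ∅ := by
  ext ⟨f, a, b⟩
  refine iff_of_false ?_ (Set.notMem_empty _)
  rintro ⟨hf, h⟩
  obtain ⟨-, g, -, hg⟩ := (twoRemovable_iff hf.1).1 h
  have := hf.2
  dsimp only at hg this
  rw [hg] at this
  simp only [map_add, Finsupp.degree_single] at this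
  omega

theorem ncard_twoAddableRows (n : ℕ) : (twoAddableRows n).ncard =
    2 * (antitoneOfDegree n).ncard + (removableRows n).ncard + (twoRemovableRows n).ncard := by
  have hu : twoAddableRows n =
      (fun f => (f, 0, 0)) '' antitoneOfDegree n ∪ (fun f => (f, 0, 1)) '' antitoneOfDegree n ∪
        (fun p => (p.1, p.2 + 1, p.2 + 2)) '' removableRows n ∪
        (fun p => (p.1, if p.2.2 = p.2.1 + 1 then 0 else p.2.1 + 1, p.2.2 + 1)) ''
          twoRemovableRows n := by
    ext ⟨f, a, b⟩
    constructor
    · rintro ⟨hf, h⟩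
      dsimp only at hf h
      rcases h with ⟨rfl, h⟩ | ⟨rfl, h⟩ | ⟨hab, ha, hb⟩
      · cases a with
        | zero => exact Or.inl (Or.inl (Or.inl ⟨f, hf, rfl⟩))
        | succ a =>
          exact Or.inr ⟨(f, a, a), ⟨hf, Or.inl ⟨rfl, by simpa using h⟩⟩, by simp⟩
      · cases a with
        | zero => exact Or.inl (Or.inl (Or.inr ⟨f, hf, rfl⟩))
        | succ a => exact Or.inl (Or.inr ⟨(f, a), ⟨hf, by simpa using h⟩, rfl⟩)
      · obtain ⟨b, rfl⟩ := Nat.exists_eq_add_of_le' (Nat.one_le_of_lt hab)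
        cases a with
        | zero =>
          obtain ⟨b, rfl⟩ := Nat.exists_eq_add_of_le' (Nat.lt_of_add_lt_add_right hab)
          exact Or.inr ⟨(f, b, b + 1), ⟨hf, Or.inr (Or.inl ⟨rfl, hb⟩)⟩, by simp⟩
        | succ a =>
          refine Or.inr ⟨(f, a, b), ⟨hf, Or.inr (Or.inr
            ⟨by dsimp only; omega, by simpa using ha, hb⟩)⟩, ?_⟩
          simp [show b ≠ a + 1 by omega]
    · rintro (((⟨f, hf, he⟩ | ⟨f, hf, he⟩) | ⟨⟨f, a⟩, ⟨hf, h⟩, he⟩) | ⟨⟨f, a, b⟩, ⟨hf, h⟩, he⟩) <;>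
        cases he
      · exact ⟨hf, Or.inl ⟨rfl, Or.inl rfl⟩⟩
      · exact ⟨hf, Or.inr (Or.inl ⟨rfl, Or.inl rfl⟩)⟩
      · exact ⟨hf, Or.inr (Or.inl ⟨rfl, Or.inr h⟩)⟩
      · refine ⟨hf, ?_⟩
        simp only [TwoRemovable, TwoAddable] at h ⊢
        grind
  have hY := finite_antitoneOfDegree n
  rw [hu, Set.ncard_union_eq _ (((hY.image _).union (hY.image _)).union
    ((finite_removableRows n).image _)) ((finite_twoRemovableRows n).image _),
    Set.ncard_union_eq _ ((hY.image _).union (hY.image _)) ((finite_removableRows n).image _),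
    Set.ncard_union_eq _ (hY.image _) (hY.image _), Set.InjOn.ncard_image, Set.InjOn.ncard_image,
    Set.InjOn.ncard_image, Set.InjOn.ncard_image, two_mul]
  · rintro ⟨f, a, b⟩ ⟨-, h⟩ ⟨f', a', b'⟩ ⟨-, h'⟩ he
    simp only [TwoRemovable, Prod.mk.injEq] at h h' he ⊢
    grind
  · rintro ⟨f, a⟩ - ⟨f', a'⟩ - h
    simpa using h
  · intro f _ f' _ h
    simpa using h
  · intro f _ f' _ h
    simpa using h
  · rw [Set.disjoint_left]
    rintro _ ⟨f, -, rfl⟩ ⟨f', -, h⟩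
    simp at h
  · rw [Set.disjoint_left]
    rintro _ (⟨f, -, rfl⟩ | ⟨f, -, rfl⟩) ⟨⟨f', a⟩, -, h⟩ <;> simp at h
  · rw [Set.disjoint_left]
    rintro _ ((⟨f, -, rfl⟩ | ⟨f, -, rfl⟩) | ⟨⟨f, a⟩, -, rfl⟩) ⟨⟨f', a', b'⟩, ⟨-, h'⟩, h⟩ <;>
      simp only [TwoRemovable, Prod.mk.injEq] at h h' <;> grind

/-- `(1 − q)(1 − q²)·FZ₂(q) = (2 − q)·Z(q)` in `ℤ⟦q⟧`. -/
theorem stmt_1 :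
    (1 - PowerSeries.X) * (1 - PowerSeries.X ^ 2) * FZ 2 = (2 - PowerSeries.X) * Zq := by
  let R : PowerSeries ℤ := PowerSeries.mk fun n => ((removableRows n).ncard : ℤ)
  have hR : R = PowerSeries.X * (Zq + R) := by
    ext n
    cases n with
    | zero => simp [R, removableRows_zero]
    | succ n => simp [R, Zq, PowerSeries.coeff_succ_X_mul, ncard_removableRows_succ,
        partitionCount_eq_ncard]
  have hF : FZ 2 = 2 * Zq + R + PowerSeries.X ^ 2 * FZ 2 := by
    ext n
    have h2 : (2 : PowerSeries ℤ) = PowerSeries.C 2 := rfl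
    have h := ncard_twoAddableRows n
    rw [← nestedPairCount_two_eq_ncard_twoAddableRows, ← partitionCount_eq_ncard] at h
    have h' := congrArg (Nat.cast : ℕ → ℤ) h
    push_cast at h'
    rw [map_add, map_add, PowerSeries.coeff_X_pow_mul', h2, PowerSeries.coeff_C_mul]
    split_ifs with hn
    · obtain ⟨m, rfl⟩ := Nat.exists_eq_add_of_le' hn
      simpa [FZ, Zq, R, nestedPairCount_two_eq_ncard_twoRemovableRows m] using h'
    · simpa [FZ, Zq, R, twoRemovableRows_eq_empty (not_le.1 hn)] using h'
  linear_combination (1 - PowerSeries.X) * hF + hR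
end

section
/- In the ring of formal power series ℤ⟦q⟧ one has the identity (1 − q)(1 − q²)(1 − q³) · FZ₃(q) = (3 − q − q²) · Z(q). -/
open PowerSeries

/-- The fibres of `w : α → ℕ` are finite and `F` is their generating series. -/
def HasGenSeries {α : Type*} (w : α → ℕ) (F : PowerSeries ℤ) : Prop :=
  ∀ n, Finite {a // w a = n} ∧ (Nat.card {a // w a = n} : ℤ) = PowerSeries.coeff n F

namespace HasGenSeries

theorem unique {α : Type*} {w : α → ℕ} {F G : PowerSeries ℤ} (hF : HasGenSeries w F)
    (hG : HasGenSeries w G) : F = G := by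
  ext n
  rw [← (hF n).2, (hG n).2]

theorem congr {α β : Type*} {w : α → ℕ} {v : β → ℕ} {F : PowerSeries ℤ}
    (hF : HasGenSeries v F) (e : α ≃ β) (h : ∀ a, v (e a) = w a) : HasGenSeries w F := by
  intro n
  have e' : {a // w a = n} ≃ {b // v b = n} :=
    e.subtypeEquiv fun a => by rw [h]
  have := (hF n).1
  exact ⟨Finite.of_equiv _ e'.symm, by rw [Nat.card_congr e', (hF n).2]⟩

theorem sum {α β : Type*} {w : α → ℕ} {v : β → ℕ} {F G : PowerSeries ℤ}
    (hF : HasGenSeries w F) (hG : HasGenSeries v G) :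
    HasGenSeries (Sum.elim w v) (F + G) := by
  intro n
  have := (hF n).1
  have := (hG n).1
  have e : {c // Sum.elim w v c = n} ≃ {a // w a = n} ⊕ {b // v b = n} := Equiv.subtypeSum
  refine ⟨Finite.of_equiv _ e.symm, ?_⟩
  rw [Nat.card_congr e, Nat.card_sum, map_add, ← (hF n).2, ← (hG n).2]
  push_cast
  rfl

theorem prod {α β : Type*} {w : α → ℕ} {v : β → ℕ} {F G : PowerSeries ℤ}
    (hF : HasGenSeries w F) (hG : HasGenSeries v G) :
    HasGenSeries (fun p : α × β => w p.1 + v p.2) (F * G) := by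
  intro n
  have := fun n => (hF n).1
  have := fun n => (hG n).1
  let e : {p : α × β // w p.1 + v p.2 = n} ≃
      Σ x : Finset.HasAntidiagonal.antidiagonal n, {a // w a = x.1.1} × {b // v b = x.1.2} :=
    { toFun := fun p => ⟨⟨(w p.1.1, v p.1.2), by simpa using p.2⟩, ⟨p.1.1, rfl⟩, ⟨p.1.2, rfl⟩⟩
      invFun := fun x => ⟨(x.2.1.1, x.2.2.1), by
        rw [x.2.1.2, x.2.2.2]; exact Finset.HasAntidiagonal.mem_antidiagonal.1 x.1.2⟩
      left_inv := fun p => rfl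
      right_inv := by
        rintro ⟨⟨⟨i, j⟩, h⟩, ⟨a, ha⟩, ⟨b, hb⟩⟩
        dsimp only at ha hb
        subst ha hb
        rfl }
  refine ⟨Finite.of_equiv _ e.symm, ?_⟩
  rw [Nat.card_congr e, Nat.card_sigma, PowerSeries.coeff_mul,
    ← Finset.sum_coe_sort (Finset.HasAntidiagonal.antidiagonal n)]
  push_cast
  refine Finset.sum_congr rfl fun x _ => ?_
  rw [Nat.card_prod, ← (hF _).2, ← (hG _).2]
  push_cast
  rfl

theorem const (c : ℕ) : HasGenSeries (fun _ : Unit => c) (PowerSeries.X ^ c) := by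
  intro n
  refine ⟨inferInstance, ?_⟩
  rw [PowerSeries.coeff_X_pow]
  split_ifs with h
  · have : Unique {a : Unit // c = n} := ⟨⟨⟨(), h.symm⟩⟩, fun _ => rfl⟩
    simp
  · have : IsEmpty {a : Unit // c = n} := ⟨fun a => h a.2.symm⟩
    simp

theorem shift {α : Type*} {w : α → ℕ} {F : PowerSeries ℤ} (hF : HasGenSeries w F) (c : ℕ) :
    HasGenSeries (fun a => w a + c) (PowerSeries.X ^ c * F) :=
  ((const c).prod hF).congr (Equiv.uniqueProd α Unit).symm fun a => by
    simp [add_comm]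

theorem natProd {β : Type*} {w : ℕ × β → ℕ} {F G : PowerSeries ℤ}
    (hF : HasGenSeries (fun b => w (0, b)) F)
    (hG : HasGenSeries (fun p : ℕ × β => w (p.1 + 1, p.2)) G) : HasGenSeries w (F + G) := by
  let e : ℕ × β ≃ β ⊕ ℕ × β :=
    { toFun := fun p => match p with
        | (0, b) => Sum.inl b
        | (k + 1, b) => Sum.inr (k, b)
      invFun := Sum.elim (fun b => (0, b)) fun p => (p.1 + 1, p.2)
      left_inv := by rintro ⟨_ | k, b⟩ <;> rfl
      right_inv := by rintro (b | ⟨k, b⟩) <;> rfl }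
  exact (hF.sum hG).congr e (by rintro ⟨_ | k, b⟩ <;> rfl)

theorem of_finite {α : Type*} (w : α → ℕ) (h : ∀ n, Finite {a // w a = n}) :
    HasGenSeries w (PowerSeries.mk fun n => (Nat.card {a // w a = n} : ℤ)) :=
  fun n => ⟨h n, by simp⟩

theorem exists_geometric (d : ℕ) (hd : 0 < d) :
    ∃ G : PowerSeries ℤ, HasGenSeries (fun i : ℕ => d * i) G ∧ (1 - PowerSeries.X ^ d) * G = 1 := by
  have hG := of_finite (fun i : ℕ => d * i) fun n => by
    have : Function.Injective fun i : {i : ℕ // d * i = n} => (⟨i.1, by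
        have := i.2; nlinarith⟩ : Fin (n + 1)) := by
      intro i j h
      simpa [Subtype.ext_iff] using h
    exact Finite.of_injective _ this
  refine ⟨_, hG, ?_⟩
  have h := (natProd (w := fun p : ℕ × Unit => d * p.1) ((const 0).congr (Equiv.refl _) (by simp))
    ((hG.shift d).congr (Equiv.prodPUnit ℕ) (by simp [mul_add]))).unique
    (hG.congr (Equiv.prodPUnit ℕ) (by simp))
  rw [pow_zero] at h
  linear_combination -h

end HasGenSeries

namespace YoungDiagram

/-- The row lengths of a Young diagram as a finitely supported function. -/
noncomputable def rowsFinsupp (μ : YoungDiagram) : ℕ →₀ ℕ :=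
  Finsupp.onFinset (μ.cells.image Prod.fst) μ.rowLen fun i hi =>
    Finset.mem_image.2 ⟨(i, 0), mem_iff_lt_rowLen.2 (Nat.pos_of_ne_zero hi), rfl⟩

@[simp]
theorem rowsFinsupp_apply (μ : YoungDiagram) (i : ℕ) : μ.rowsFinsupp i = μ.rowLen i := rfl

theorem degree_rowsFinsupp (μ : YoungDiagram) : μ.rowsFinsupp.degree = μ.card := by
  have h : μ.rowsFinsupp.support ⊆ μ.cells.image Prod.fst := Finsupp.support_onFinset_subset
  rw [Finsupp.degree_apply, Finset.sum_subset h (by simp), YoungDiagram.card,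
    Finset.card_eq_sum_card_image Prod.fst]
  refine Finset.sum_congr rfl fun i _ => ?_
  rw [rowsFinsupp_apply, rowLen_eq_card, row]

/-- The Young diagram with prescribed weakly decreasing row lengths. -/
def ofRowsFinsupp (f : ℕ →₀ ℕ) (hf : Antitone f) : YoungDiagram where
  cells := (f.support ×ˢ Finset.range (f 0)).filter fun c => c.2 < f c.1
  isLowerSet := by
    rintro ⟨a, b⟩ ⟨c, d⟩ ⟨hca : c ≤ a, hdb : d ≤ b⟩ h
    have h0 := hf (Nat.zero_le c)
    have h1 := hf hca
    simp only [Finset.coe_filter, Finset.mem_product, Finsupp.mem_support_iff, Finset.mem_range,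
      Set.mem_ofPred_eq] at h ⊢
    omega

theorem mem_ofRowsFinsupp {f : ℕ →₀ ℕ} {hf : Antitone f} {i j : ℕ} :
    (i, j) ∈ ofRowsFinsupp f hf ↔ j < f i := by
  have h0 := hf (Nat.zero_le i)
  rw [← mem_cells]
  simp only [ofRowsFinsupp, Finset.mem_filter, Finset.mem_product, Finsupp.mem_support_iff, Finset.mem_range]
  omega

/-- Young diagrams are the same as finitely supported weakly decreasing sequences. -/
noncomputable def equivRowsFinsupp : YoungDiagram ≃ {f : ℕ →₀ ℕ // Antitone f} where
  toFun μ := ⟨μ.rowsFinsupp, fun i j h => μ.rowLen_anti i j h⟩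
  invFun f := ofRowsFinsupp f.1 f.2
  left_inv μ := by
    ext ⟨i, j⟩
    rw [mem_cells, mem_cells, mem_ofRowsFinsupp, mem_iff_lt_rowLen, rowsFinsupp_apply]
  right_inv f := by
    ext i
    refine eq_of_forall_lt_iff fun j => ?_
    rw [rowsFinsupp_apply, ← mem_iff_lt_rowLen, mem_ofRowsFinsupp]

theorem degree_equivRowsFinsupp (μ : YoungDiagram) : (equivRowsFinsupp μ).1.degree = μ.card :=
  μ.degree_rowsFinsupp

theorem le_iff_rowLen_le {μ ν : YoungDiagram} : μ ≤ ν ↔ ∀ i, μ.rowLen i ≤ ν.rowLen i := by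
  constructor
  · intro h i
    refine le_of_forall_lt fun j hj => ?_
    rw [← mem_iff_lt_rowLen] at hj ⊢
    exact h hj
  · rintro h ⟨i, j⟩ hj
    exact mem_iff_lt_rowLen.2 ((mem_iff_lt_rowLen.1 hj).trans_le (h i))

theorem finite_card_eq (n : ℕ) : Finite {μ : YoungDiagram // μ.card = n} := by
  have hsub : ∀ μ : YoungDiagram, μ.card = n →
      μ.cells ∈ (Finset.range n ×ˢ Finset.range n).powerset := by
    rintro μ rfl
    rw [Finset.mem_powerset]
    rintro ⟨i, j⟩ h
    have hr : (μ.row i).card ≤ μ.card := Finset.card_le_card (Finset.filter_subset _ _)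
    have hc : (μ.col j).card ≤ μ.card := Finset.card_le_card (Finset.filter_subset _ _)
    rw [← rowLen_eq_card] at hr
    rw [← colLen_eq_card] at hc
    have h1 := mem_iff_lt_rowLen.1 h
    have h2 := mem_iff_lt_colLen.1 h
    simp only [Finset.mem_product, Finset.mem_range]
    omega
  refine Finite.of_injective (fun μ : {μ : YoungDiagram // μ.card = n} =>
    (⟨μ.1.cells, hsub μ.1 μ.2⟩ : {s // s ∈ (Finset.range n ×ˢ Finset.range n).powerset})) ?_
  intro μ ν h
  exact Subtype.ext (YoungDiagram.ext (congrArg Subtype.val h))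

end YoungDiagram

/-- The sequence whose `i`-th term is `∑ k > i, g k`. -/
noncomputable def strictTailSum (g : ℕ →₀ ℕ) : ℕ →₀ ℕ :=
  g.sum fun k m => ∑ i ∈ Finset.range k, Finsupp.single i m

theorem strictTailSum_add (f g : ℕ →₀ ℕ) :
    strictTailSum (f + g) = strictTailSum f + strictTailSum g :=
  Finsupp.sum_add_index' (by simp) (by simp [Finset.sum_add_distrib])

theorem strictTailSum_single (k m : ℕ) :
    strictTailSum (Finsupp.single k m) = ∑ i ∈ Finset.range k, Finsupp.single i m :=
  Finsupp.sum_single_index (by simp)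

theorem strictTailSum_apply (g : ℕ →₀ ℕ) (i : ℕ) :
    strictTailSum g i = strictTailSum g (i + 1) + g (i + 1) := by
  induction g using Finsupp.induction_linear with
  | zero => simp [strictTailSum]
  | add f g hf hg => simp only [strictTailSum_add, Finsupp.add_apply, hf, hg]; omega
  | single k m =>
    simp only [strictTailSum_single, Finsupp.finsetSum_apply, Finsupp.single_apply,
      Finset.sum_ite_eq', Finset.mem_range]
    split_ifs <;> omega

theorem degree_strictTailSum (g : ℕ →₀ ℕ) :
    (strictTailSum g).degree = g.sum fun k m => k * m := by
  induction g using Finsupp.induction_linear with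
  | zero => simp [strictTailSum]
  | add f g hf hg =>
    rw [strictTailSum_add, map_add, hf, hg, Finsupp.sum_add_index' (by simp) (by simp [mul_add])]
  | single k m => simp [strictTailSum_single]

/-- The truncated differences `δ k - δ (k - 1)`, where `δ (-1) = 0`. -/
noncomputable def rises (δ : ℕ →₀ ℕ) : ℕ →₀ ℕ :=
  Finsupp.onFinset δ.support (fun k => δ k - if k = 0 then 0 else δ (k - 1)) fun k hk => by
    rw [Finsupp.mem_support_iff]; omega

theorem rises_apply (δ : ℕ →₀ ℕ) (k : ℕ) :
    rises δ k = δ k - if k = 0 then 0 else δ (k - 1) := rfl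

/-- The size of the smallest `μ` such that `μ` and `μ + δ` are both weakly decreasing. -/
noncomputable def riseWeight (δ : ℕ →₀ ℕ) : ℕ :=
  (rises δ).sum fun k m => k * m

theorem strictTailSum_rises_apply (δ : ℕ →₀ ℕ) (i : ℕ) :
    strictTailSum (rises δ) i = strictTailSum (rises δ) (i + 1) + (δ (i + 1) - δ i) := by
  rw [strictTailSum_apply]; simp [rises_apply]

theorem strictTailSum_rises_le {μ δ : ℕ →₀ ℕ} (hμ : Antitone μ) (hν : Antitone (μ + δ)) :
    strictTailSum (rises δ) ≤ μ := by
  obtain ⟨N, hN⟩ := (strictTailSum (rises δ)).support.exists_nat_subset_range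
  have key : ∀ n i, N ≤ i + n → strictTailSum (rises δ) i ≤ μ i := by
    intro n
    induction n with
    | zero =>
      intro i hi
      have : strictTailSum (rises δ) i = 0 := by
        by_contra h
        have := Finset.mem_range.1 (hN (Finsupp.mem_support_iff.2 h))
        omega
      omega
    | succ n ih =>
      intro i hi
      have h1 := ih (i + 1) (by omega)
      have h2 := strictTailSum_rises_apply δ i
      have h3 := hμ (Nat.le_succ i)
      have h4 := hν (Nat.le_succ i)
      simp only [Finsupp.add_apply, Nat.succ_eq_add_one] at h3 h4
      omega
  exact fun i => key N i (by omega)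

theorem antitone_sub_strictTailSum_rises {μ δ : ℕ →₀ ℕ} (hμ : Antitone μ)
    (hν : Antitone (μ + δ)) : Antitone (μ - strictTailSum (rises δ)) := by
  refine antitone_nat_of_succ_le fun i => ?_
  have h2 := strictTailSum_rises_apply δ i
  have h3 := hμ (Nat.le_succ i)
  have h4 := hν (Nat.le_succ i)
  simp only [Finsupp.add_apply, Finsupp.tsub_apply, Nat.succ_eq_add_one] at h3 h4 ⊢
  omega

theorem antitone_add_strictTailSum_rises {l : ℕ →₀ ℕ} (δ : ℕ →₀ ℕ) (hl : Antitone l) :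
    Antitone (l + strictTailSum (rises δ)) := by
  refine antitone_nat_of_succ_le fun i => ?_
  have h2 := strictTailSum_rises_apply δ i
  have h3 := hl (Nat.le_succ i)
  simp only [Finsupp.add_apply, Nat.succ_eq_add_one] at h3 ⊢
  omega

theorem antitone_add_strictTailSum_rises_add {l : ℕ →₀ ℕ} (δ : ℕ →₀ ℕ) (hl : Antitone l) :
    Antitone (l + strictTailSum (rises δ) + δ) := by
  refine antitone_nat_of_succ_le fun i => ?_
  have h2 := strictTailSum_rises_apply δ i
  have h3 := hl (Nat.le_succ i)
  simp only [Finsupp.add_apply, Nat.succ_eq_add_one] at h3 ⊢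
  omega

/-- Nested pairs of weakly decreasing sequences correspond to pairs consisting of their difference
and the excess of the smaller sequence over the smallest one allowing that difference. -/
noncomputable def nestedPairEquiv :
    {p : {f : ℕ →₀ ℕ // Antitone f} × {f : ℕ →₀ ℕ // Antitone f} // p.1.1 ≤ p.2.1} ≃
      (ℕ →₀ ℕ) × {f : ℕ →₀ ℕ // Antitone f} where
  toFun p := (p.1.2.1 - p.1.1.1, ⟨p.1.1.1 - strictTailSum (rises (p.1.2.1 - p.1.1.1)),
    antitone_sub_strictTailSum_rises p.1.1.2 (by
      rw [add_tsub_cancel_of_le p.2]; exact p.1.2.2)⟩)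
  invFun x := ⟨(⟨x.2.1 + strictTailSum (rises x.1), antitone_add_strictTailSum_rises x.1 x.2.2⟩,
    ⟨x.2.1 + strictTailSum (rises x.1) + x.1, antitone_add_strictTailSum_rises_add x.1 x.2.2⟩),
    le_self_add⟩
  left_inv := by
    rintro ⟨⟨⟨μ, hμ⟩, ⟨ν, hν⟩⟩, h : μ ≤ ν⟩
    have hle : strictTailSum (rises (ν - μ)) ≤ μ := strictTailSum_rises_le hμ (by
      rw [add_tsub_cancel_of_le h]; exact hν)
    ext1
    ext1
    · ext1
      exact tsub_add_cancel_of_le hle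
    · ext1
      change μ - strictTailSum (rises (ν - μ)) + strictTailSum (rises (ν - μ)) + (ν - μ) = ν
      rw [tsub_add_cancel_of_le hle, add_tsub_cancel_of_le h]
  right_inv := by
    rintro ⟨δ, ⟨l, hl⟩⟩
    have h : l + strictTailSum (rises δ) + δ - (l + strictTailSum (rises δ)) = δ :=
      add_tsub_cancel_left _ _
    ext1
    · exact h
    · ext1
      change l + strictTailSum (rises δ) - strictTailSum (rises (l + strictTailSum (rises δ) + δ -
        (l + strictTailSum (rises δ)))) = l
      rw [h, add_tsub_cancel_right]

theorem nestedPairEquiv_degree_fst (p : {p : {f : ℕ →₀ ℕ // Antitone f} ×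
    {f : ℕ →₀ ℕ // Antitone f} // p.1.1 ≤ p.2.1}) :
    p.1.1.1.degree = riseWeight (nestedPairEquiv p).1 + (nestedPairEquiv p).2.1.degree := by
  obtain ⟨x, rfl⟩ := nestedPairEquiv.symm.surjective p
  rw [Equiv.apply_symm_apply]
  change (x.2.1 + strictTailSum (rises x.1)).degree = _
  rw [map_add, degree_strictTailSum, riseWeight, add_comm]

theorem nestedPairEquiv_degree_snd (p : {p : {f : ℕ →₀ ℕ // Antitone f} ×
    {f : ℕ →₀ ℕ // Antitone f} // p.1.1 ≤ p.2.1}) :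
    p.1.2.1.degree = p.1.1.1.degree + (nestedPairEquiv p).1.degree := by
  change _ = _ + (p.1.2.1 - p.1.1.1).degree
  rw [← map_add, add_tsub_cancel_of_le p.2]

theorem hasGenSeries_Zq : HasGenSeries YoungDiagram.card Zq :=
  HasGenSeries.of_finite _ YoungDiagram.finite_card_eq

open YoungDiagram in
/-- Nested pairs of Young diagrams correspond to pairs consisting of the differences of their row
lengths and a Young diagram. -/
noncomputable def nestedYoungDiagramEquiv :
    {p : YoungDiagram × YoungDiagram // p.1 ≤ p.2} ≃ (ℕ →₀ ℕ) × YoungDiagram :=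
  ((equivRowsFinsupp.prodCongr equivRowsFinsupp).subtypeEquiv fun _ => le_iff_rowLen_le).trans
    (nestedPairEquiv.trans ((Equiv.refl _).prodCongr equivRowsFinsupp.symm))

theorem card_fst_nestedYoungDiagramEquiv (p : {p : YoungDiagram × YoungDiagram // p.1 ≤ p.2}) :
    p.1.1.card =
      riseWeight (nestedYoungDiagramEquiv p).1 + (nestedYoungDiagramEquiv p).2.card := by
  rw [← YoungDiagram.degree_equivRowsFinsupp, ← YoungDiagram.degree_equivRowsFinsupp]
  simp only [nestedYoungDiagramEquiv, Equiv.trans_apply, Equiv.prodCongr_apply, Prod.map_fst,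
    Prod.map_snd, Equiv.refl_apply, Equiv.apply_symm_apply]
  exact nestedPairEquiv_degree_fst
    ⟨(YoungDiagram.equivRowsFinsupp p.1.1, YoungDiagram.equivRowsFinsupp p.1.2),
      YoungDiagram.le_iff_rowLen_le.1 p.2⟩

theorem card_snd_nestedYoungDiagramEquiv (p : {p : YoungDiagram × YoungDiagram // p.1 ≤ p.2}) :
    p.1.2.card = p.1.1.card + (nestedYoungDiagramEquiv p).1.degree := by
  rw [← YoungDiagram.degree_equivRowsFinsupp, ← YoungDiagram.degree_equivRowsFinsupp]
  exact nestedPairEquiv_degree_snd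
    ⟨(YoungDiagram.equivRowsFinsupp p.1.1, YoungDiagram.equivRowsFinsupp p.1.2),
      YoungDiagram.le_iff_rowLen_le.1 p.2⟩

theorem FZ_eq_mul_Zq {D : ℕ} {W : PowerSeries ℤ}
    (hW : HasGenSeries (fun δ : {δ : ℕ →₀ ℕ // δ.degree = D} => riseWeight δ.1) W) :
    FZ D = W * Zq := by
  ext n
  rw [FZ, PowerSeries.coeff_mk, ← ((hW.prod hasGenSeries_Zq) n).2, nestedPairCount]
  congr 1
  have e₁ : {p : YoungDiagram × YoungDiagram //
      p.1 ≤ p.2 ∧ p.1.card = n ∧ p.2.card = n + D} ≃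
      {x : (ℕ →₀ ℕ) × YoungDiagram // x.1.degree = D ∧ riseWeight x.1 + x.2.card = n} :=
    (Equiv.subtypeSubtypeEquivSubtypeInter (fun p : YoungDiagram × YoungDiagram => p.1 ≤ p.2)
      fun p => p.1.card = n ∧ p.2.card = n + D).symm.trans
      (nestedYoungDiagramEquiv.subtypeEquiv fun p => by
        have h₁ := card_fst_nestedYoungDiagramEquiv p
        have h₂ := card_snd_nestedYoungDiagramEquiv p
        omega)
  refine Nat.card_congr (e₁.trans ?_)
  exact
    { toFun := fun x => ⟨(⟨x.1.1, x.2.1⟩, x.1.2), x.2.2⟩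
      invFun := fun x => ⟨(x.1.1.1, x.1.2), x.1.1.2, x.2⟩
      left_inv := fun _ => rfl
      right_inv := fun _ => rfl }

/-- The indicator of the multiset `{i, i + s, i + s + t}`, for `p = (s, t, i)`. -/
noncomputable def threePoints (p : ℕ × ℕ × ℕ) : ℕ →₀ ℕ :=
  Finsupp.single p.2.2 1 + Finsupp.single (p.2.2 + p.1) 1 +
    Finsupp.single (p.2.2 + p.1 + p.2.1) 1

theorem toMultiset_threePoints (p : ℕ × ℕ × ℕ) :
    Finsupp.toMultiset (threePoints p) =
      ([p.2.2, p.2.2 + p.1, p.2.2 + p.1 + p.2.1] : List ℕ) := by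
  simp only [threePoints, map_add, Finsupp.toMultiset_single, one_smul]
  rfl

theorem threePoints_injective : Function.Injective threePoints := by
  rintro ⟨s, t, i⟩ ⟨s', t', i'⟩ h
  have h' := congrArg Finsupp.toMultiset h
  rw [toMultiset_threePoints, toMultiset_threePoints, Multiset.coe_eq_coe] at h'
  have := h'.eq_of_pairwise' (r := (· ≤ ·)) (by simp; omega) (by simp; omega)
  simp only [List.cons.injEq] at this
  simp only [Prod.mk.injEq]
  omega

theorem degree_threePoints (p : ℕ × ℕ × ℕ) : (threePoints p).degree = 3 := by
  simp [threePoints]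

theorem exists_threePoints_eq {δ : ℕ →₀ ℕ} (h : δ.degree = 3) : ∃ p, threePoints p = δ := by
  have hcard : (Finsupp.toMultiset δ).card = 3 := by
    rw [Finsupp.card_toMultiset, ← h]; rfl
  have hlen : ((Finsupp.toMultiset δ).sort (· ≤ ·)).length = 3 := by simpa using hcard
  have hsort := Multiset.pairwise_sort (Finsupp.toMultiset δ) (· ≤ ·)
  have heq := Multiset.sort_eq (Finsupp.toMultiset δ) (· ≤ ·)
  obtain ⟨a, b, c, hl⟩ := List.length_eq_three.1 hlen
  rw [hl] at hsort heq
  simp only [List.pairwise_cons, List.mem_cons, List.not_mem_nil, or_false, forall_eq_or_imp,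
    forall_eq] at hsort
  refine ⟨(b - a, c - b, a), Multiset.toFinsupp.symm.injective ?_⟩
  change Finsupp.toMultiset _ = Finsupp.toMultiset δ
  rw [toMultiset_threePoints, ← heq]
  have hb : a + (b - a) = b := by omega
  have hc : b + (c - b) = c := by omega
  simp only [hb, hc]

/-- Sequences of total sum `3` are parametrized by triples of natural numbers. -/
noncomputable def threePointsEquiv : {δ : ℕ →₀ ℕ // δ.degree = 3} ≃ ℕ × ℕ × ℕ :=
  (Equiv.ofBijective (fun p => (⟨threePoints p, degree_threePoints p⟩ : {δ : ℕ →₀ ℕ //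
    δ.degree = 3})) ⟨fun _ _ h => threePoints_injective (congrArg Subtype.val h), fun δ => by
      obtain ⟨p, hp⟩ := exists_threePoints_eq δ.2
      exact ⟨p, Subtype.ext hp⟩⟩).symm

theorem threePoints_threePointsEquiv (δ : {δ : ℕ →₀ ℕ // δ.degree = 3}) :
    threePoints (threePointsEquiv δ) = δ.1 :=
  congrArg Subtype.val (threePointsEquiv.symm_apply_apply δ)

theorem riseWeight_eq_of_rises_eq {δ : ℕ →₀ ℕ} {a b c x y z : ℕ}
    (h : ∀ k, rises δ k =
      (if a = k then x else 0) + (if b = k then y else 0) + (if c = k then z else 0)) :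
    riseWeight δ = a * x + b * y + c * z := by
  have h' : rises δ = Finsupp.single a x + Finsupp.single b y + Finsupp.single c z := by
    ext k
    simp only [h, Finsupp.add_apply, Finsupp.single_apply]
  rw [riseWeight, h']
  repeat rw [Finsupp.sum_add_index' (by simp) (by simp [mul_add])]
  simp

section

variable (s t i : ℕ)

theorem riseWeight_threePoints_zero_zero : riseWeight (threePoints (0, 0, i)) = 3 * i := by
  rw [riseWeight_eq_of_rises_eq (a := i) (b := 0) (c := 0) (x := 3) (y := 0) (z := 0)]
  · ring
  · intro k
    simp only [rises_apply, threePoints, Finsupp.add_apply, Finsupp.single_apply]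
    grind

theorem riseWeight_threePoints_zero_one : riseWeight (threePoints (0, 1, i)) = 2 * i := by
  rw [riseWeight_eq_of_rises_eq (a := i) (b := 0) (c := 0) (x := 2) (y := 0) (z := 0)]
  · ring
  · intro k
    simp only [rises_apply, threePoints, Finsupp.add_apply, Finsupp.single_apply]
    grind

theorem riseWeight_threePoints_zero_add_two :
    riseWeight (threePoints (0, t + 1 + 1, i)) = 1 * t + 3 * i + 2 := by
  rw [riseWeight_eq_of_rises_eq (a := i) (b := i + t + 2) (c := 0) (x := 2) (y := 1) (z := 0)]
  · ring
  · intro k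
    simp only [rises_apply, threePoints, Finsupp.add_apply, Finsupp.single_apply]
    grind

theorem riseWeight_threePoints_one_zero : riseWeight (threePoints (1, 0, i)) = 2 * i + 1 := by
  rw [riseWeight_eq_of_rises_eq (a := i) (b := i + 1) (c := 0) (x := 1) (y := 1) (z := 0)]
  · ring
  · intro k
    simp only [rises_apply, threePoints, Finsupp.add_apply, Finsupp.single_apply]
    grind

theorem riseWeight_threePoints_one_one : riseWeight (threePoints (1, 1, i)) = 1 * i := by
  rw [riseWeight_eq_of_rises_eq (a := i) (b := 0) (c := 0) (x := 1) (y := 0) (z := 0)]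
  · ring
  · intro k
    simp only [rises_apply, threePoints, Finsupp.add_apply, Finsupp.single_apply]
    grind

theorem riseWeight_threePoints_one_add_two :
    riseWeight (threePoints (1, t + 1 + 1, i)) = 1 * t + 2 * i + 3 := by
  rw [riseWeight_eq_of_rises_eq (a := i) (b := i + t + 3) (c := 0) (x := 1) (y := 1) (z := 0)]
  · ring
  · intro k
    simp only [rises_apply, threePoints, Finsupp.add_apply, Finsupp.single_apply]
    grind

theorem riseWeight_threePoints_add_two_zero :
    riseWeight (threePoints (s + 1 + 1, 0, i)) = 2 * s + 3 * i + 4 := by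
  rw [riseWeight_eq_of_rises_eq (a := i) (b := i + s + 2) (c := 0) (x := 1) (y := 2) (z := 0)]
  · ring
  · intro k
    simp only [rises_apply, threePoints, Finsupp.add_apply, Finsupp.single_apply]
    grind

theorem riseWeight_threePoints_add_two_one :
    riseWeight (threePoints (s + 1 + 1, 1, i)) = 1 * s + 2 * i + 2 := by
  rw [riseWeight_eq_of_rises_eq (a := i) (b := i + s + 2) (c := 0) (x := 1) (y := 1) (z := 0)]
  · ring
  · intro k
    simp only [rises_apply, threePoints, Finsupp.add_apply, Finsupp.single_apply]
    grind

theorem riseWeight_threePoints_add_two_add_two :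
    riseWeight (threePoints (s + 1 + 1, t + 1 + 1, i)) = 1 * t + (2 * s + 3 * i) + 6 := by
  rw [riseWeight_eq_of_rises_eq (a := i) (b := i + s + 2) (c := i + s + t + 4)
    (x := 1) (y := 1) (z := 1)]
  · ring
  · intro k
    simp only [rises_apply, threePoints, Finsupp.add_apply, Finsupp.single_apply]
    grind

end

theorem hasGenSeries_riseWeight_threePoints {G₁ G₂ G₃ : PowerSeries ℤ}
    (h₁ : HasGenSeries (fun i : ℕ => 1 * i) G₁) (h₂ : HasGenSeries (fun i : ℕ => 2 * i) G₂)
    (h₃ : HasGenSeries (fun i : ℕ => 3 * i) G₃) :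
    HasGenSeries (fun p => riseWeight (threePoints p))
      ((G₃ + (G₂ + PowerSeries.X ^ 2 * (G₁ * G₃))) +
        ((PowerSeries.X ^ 1 * G₂ + (G₁ + PowerSeries.X ^ 3 * (G₁ * G₂))) +
          (PowerSeries.X ^ 4 * (G₂ * G₃) + (PowerSeries.X ^ 2 * (G₁ * G₂) +
            PowerSeries.X ^ 6 * (G₁ * (G₂ * G₃)))))) := by
  refine .natProd (.natProd ?_ (.natProd ?_ ?_)) (.natProd (.natProd ?_ (.natProd ?_ ?_)) ?_)
  · simpa only [riseWeight_threePoints_zero_zero] using h₃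
  · simpa only [zero_add, riseWeight_threePoints_zero_one] using h₂
  · simpa only [riseWeight_threePoints_zero_add_two] using (h₁.prod h₃).shift 2
  · simpa only [zero_add, riseWeight_threePoints_one_zero] using h₂.shift 1
  · simpa only [zero_add, riseWeight_threePoints_one_one] using h₁
  · simpa only [zero_add, riseWeight_threePoints_one_add_two] using (h₁.prod h₂).shift 3
  · let e : ℕ × ℕ × ℕ ≃ ℕ × ℕ × ℕ :=
      ⟨fun p => (p.2.1, p.1, p.2.2), fun p => (p.2.1, p.1, p.2.2), fun _ => rfl, fun _ => rfl⟩
    refine HasGenSeries.congr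
      (v := fun p : ℕ × ℕ × ℕ => riseWeight (threePoints (p.2.1 + 1 + 1, p.1, p.2.2)))
      (.natProd ?_ (.natProd ?_ ?_)) e fun _ => rfl
    · simpa only [riseWeight_threePoints_add_two_zero] using (h₂.prod h₃).shift 4
    · simpa only [zero_add, riseWeight_threePoints_add_two_one] using (h₁.prod h₂).shift 2
    · simpa only [riseWeight_threePoints_add_two_add_two] using
        (h₁.prod (h₂.prod h₃)).shift 6

/-- `(1 − q)(1 − q²)(1 − q³)·FZ₃(q) = (3 − q − q²)·Z(q)` in `ℤ⟦q⟧`. -/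
theorem stmt_2 :
    (1 - PowerSeries.X) * (1 - PowerSeries.X ^ 2) * (1 - PowerSeries.X ^ 3) * FZ 3 =
      (3 - PowerSeries.X - PowerSeries.X ^ 2) * Zq := by
  obtain ⟨G₁, h₁, e₁⟩ := HasGenSeries.exists_geometric 1 (by norm_num)
  obtain ⟨G₂, h₂, e₂⟩ := HasGenSeries.exists_geometric 2 (by norm_num)
  obtain ⟨G₃, h₃, e₃⟩ := HasGenSeries.exists_geometric 3 (by norm_num)
  rw [FZ_eq_mul_Zq ((hasGenSeries_riseWeight_threePoints h₁ h₂ h₃).congr threePointsEquiv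
    fun δ => by rw [threePoints_threePointsEquiv]), ← mul_assoc]
  congr 1
  rw [pow_one] at e₁
  set a : PowerSeries ℤ := 1 - PowerSeries.X with ha
  set b : PowerSeries ℤ := 1 - PowerSeries.X ^ 2 with hb
  set c : PowerSeries ℤ := 1 - PowerSeries.X ^ 3 with hc
  have key : a * b + a * c * (1 + PowerSeries.X) + PowerSeries.X ^ 2 * b + b * c +
      (PowerSeries.X ^ 3 + PowerSeries.X ^ 2) * c + PowerSeries.X ^ 4 * a + PowerSeries.X ^ 6 =
      3 - PowerSeries.X - PowerSeries.X ^ 2 := by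
    rw [ha, hb, hc]
    ring
  linear_combination key + a * b * e₃ + a * c * (1 + PowerSeries.X) * e₂ +
    PowerSeries.X ^ 2 * b * (c * G₃ * e₁ + e₃) + b * c * e₁ +
    (PowerSeries.X ^ 3 + PowerSeries.X ^ 2) * c * (b * G₂ * e₁ + e₂) +
    PowerSeries.X ^ 4 * a * (c * G₃ * e₂ + e₃) +
    PowerSeries.X ^ 6 * (b * G₂ * (c * G₃) * e₁ + c * G₃ * e₂ + e₃)
end

section
/- In ℤ⟦q⟧ one has: (i) for every r ≥ 1, FQ_{r,1}(q) = r · FZ₁(q) · Z(q)^{r−1}; (ii) for every r ≥ 2, FQ_{r,2}(q) = r · FZ₂(q) · Z(q)^{r−1} + binom(r,2) · FZ₁(q)² · Z(q)^{r−2}. -/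
open PowerSeries

/-- The number of pairs `(Λ, M)` of `r`-coloured Young diagrams with `Λ ⊆ M`
(componentwise), `|Λ| = n` and `|M| = n + D`. -/
noncomputable def colouredPairCount (r D n : ℕ) : ℕ :=
  Nat.card {p : (Fin r → YoungDiagram) × (Fin r → YoungDiagram) //
    (∀ i, p.1 i ≤ p.2 i) ∧ (∑ i, (p.1 i).card) = n ∧ (∑ i, (p.2 i).card) = n + D}

/-- `FQ_{r,D}(q) ∈ ℤ⟦q⟧`. -/
noncomputable def FQ (r D : ℕ) : PowerSeries ℤ :=
  PowerSeries.mk fun n => (colouredPairCount r D n : ℤ)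

/-- There are finitely many Young diagrams of bounded size. -/
theorem finite_youngDiagram_card_le (N : ℕ) : {μ : YoungDiagram | μ.card ≤ N}.Finite := by
  have hinj : Set.InjOn YoungDiagram.cells {μ : YoungDiagram | μ.card ≤ N} :=
    fun _ _ _ _ h => YoungDiagram.ext h
  refine Set.Finite.of_finite_image (Set.Finite.subset
    (Finset.finite_toSet (Finset.range N ×ˢ Finset.range N).powerset) ?_) hinj
  rintro _ ⟨μ, hμ, rfl⟩
  simp only [Set.mem_ofPred_eq] at hμ
  simp only [Finset.coe_powerset, Set.mem_preimage, Set.mem_powerset_iff, Finset.coe_subset]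
  rintro ⟨i, j⟩ hij
  have hij' : (i, j) ∈ μ := hij
  have hrow : μ.rowLen i ≤ μ.card := by
    rw [YoungDiagram.rowLen_eq_card]
    exact Finset.card_le_card (Finset.filter_subset _ _)
  have hcol : μ.colLen j ≤ μ.card := by
    rw [YoungDiagram.colLen_eq_card]
    exact Finset.card_le_card (Finset.filter_subset _ _)
  have hj := YoungDiagram.mem_iff_lt_rowLen.1 hij'
  have hi := YoungDiagram.mem_iff_lt_colLen.1 hij'
  simp only [Finset.mem_product, Finset.mem_range]
  omega

theorem finite_nestedPair (D n : ℕ) :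
    Finite {p : YoungDiagram × YoungDiagram //
      p.1 ≤ p.2 ∧ p.1.card = n ∧ p.2.card = n + D} := by
  have hfin := finite_youngDiagram_card_le (n + D)
  refine Set.Finite.to_subtype ((hfin.prod hfin).subset ?_)
  rintro p ⟨-, h₁, h₂⟩
  exact ⟨by simp only [Set.mem_ofPred_eq]; omega, h₂.le⟩

theorem finite_colouredPair (r D n : ℕ) :
    Finite {p : (Fin r → YoungDiagram) × (Fin r → YoungDiagram) //
      (∀ i, p.1 i ≤ p.2 i) ∧ (∑ i, (p.1 i).card) = n ∧ (∑ i, (p.2 i).card) = n + D} := by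
  have hfin := Set.Finite.pi' fun _ : Fin r => finite_youngDiagram_card_le (n + D)
  refine Set.Finite.to_subtype ((hfin.prod hfin).subset ?_)
  rintro p ⟨-, h₁, h₂⟩
  refine ⟨fun i => ?_, fun i => ?_⟩
  · have := Finset.single_le_sum (f := fun i => (p.1 i).card) (fun _ _ => Nat.zero_le _)
      (Finset.mem_univ i)
    simp only [Set.mem_ofPred_eq] at this ⊢
    omega
  · have := Finset.single_le_sum (f := fun i => (p.2 i).card) (fun _ _ => Nat.zero_le _)
      (Finset.mem_univ i)
    simp only [Set.mem_ofPred_eq] at this ⊢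
    omega

/-- Splitting off the first colour. -/
theorem colouredPairCount_succ (r D n : ℕ) :
    colouredPairCount (r + 1) D n =
      ∑ x ∈ Finset.HasAntidiagonal.antidiagonal D, ∑ y ∈ Finset.HasAntidiagonal.antidiagonal n,
        nestedPairCount x.1 y.1 * colouredPairCount r x.2 y.2 := by
  have := finite_nestedPair
  have := finite_colouredPair r
  rw [← Finset.sum_product', ← Finset.sum_coe_sort]
  simp only [nestedPairCount, colouredPairCount, ← Nat.card_prod]
  rw [← Nat.card_sigma]
  symm
  refine Nat.card_eq_of_bijective (fun s => ⟨(Fin.cons s.2.1.1.1 s.2.2.1.1,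
    Fin.cons s.2.1.1.2 s.2.2.1.2), ?_, ?_, ?_⟩) ⟨?_, ?_⟩
  · exact Fin.cases s.2.1.2.1 s.2.2.2.1
  · obtain ⟨⟨⟨⟨a, b⟩, i, j⟩, hx⟩, ⟨p, hp⟩, q, hq⟩ := s
    simp only [Finset.mem_product, Finset.HasAntidiagonal.mem_antidiagonal] at hx hp hq
    simp only [Fin.sum_univ_succ, Fin.cons_zero, Fin.cons_succ]
    omega
  · obtain ⟨⟨⟨⟨a, b⟩, i, j⟩, hx⟩, ⟨p, hp⟩, q, hq⟩ := s
    simp only [Finset.mem_product, Finset.HasAntidiagonal.mem_antidiagonal] at hx hp hq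
    simp only [Fin.sum_univ_succ, Fin.cons_zero, Fin.cons_succ]
    omega
  · rintro ⟨⟨⟨⟨a, b⟩, i, j⟩, hx⟩, ⟨⟨p, p'⟩, hp⟩, ⟨q, q'⟩, hq⟩
      ⟨⟨⟨⟨c, d⟩, k, l⟩, hy⟩, ⟨⟨s, s'⟩, hs⟩, ⟨t, t'⟩, ht⟩ h
    simp only [Subtype.mk.injEq, Prod.mk.injEq, Fin.cons_inj] at h
    obtain ⟨⟨rfl, rfl⟩, rfl, rfl⟩ := h
    simp only [Finset.mem_product, Finset.HasAntidiagonal.mem_antidiagonal] at hx hy hp hq hs ht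
    obtain rfl : i = k := by omega
    obtain rfl : a = c := by omega
    obtain rfl : j = l := by omega
    obtain rfl : b = d := by omega
    rfl
  · rintro ⟨⟨p, q⟩, hle, hp, hq⟩
    simp only [Fin.sum_univ_succ] at hp hq hle
    have h0 : (p 0).card ≤ (q 0).card := Finset.card_le_card (hle 0)
    have h1 : ∑ i : Fin r, (p i.succ).card ≤ ∑ i : Fin r, (q i.succ).card :=
      Finset.sum_le_sum fun i _ => Finset.card_le_card (hle i.succ)
    refine ⟨⟨⟨(((q 0).card - (p 0).card,
        ∑ i : Fin r, (q i.succ).card - ∑ i : Fin r, (p i.succ).card),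
        ((p 0).card, ∑ i : Fin r, (p i.succ).card)), ?_⟩,
      ⟨(p 0, q 0), hle 0, rfl, ?_⟩,
      ⟨(fun i => p i.succ, fun i => q i.succ), fun i => hle i.succ, rfl, ?_⟩⟩, ?_⟩
    · simp only [Finset.mem_product, Finset.HasAntidiagonal.mem_antidiagonal]
      omega
    · simp only
      omega
    · simp only
      omega
    · exact Subtype.ext (Prod.ext (Fin.cons_self_tail p) (Fin.cons_self_tail q))

theorem FQ_succ (r D : ℕ) :
    FQ (r + 1) D = ∑ x ∈ Finset.HasAntidiagonal.antidiagonal D, FZ x.1 * FQ r x.2 := by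
  ext n
  simp only [FQ, FZ, map_sum, coeff_mul, coeff_mk, colouredPairCount_succ]
  push_cast
  rfl

theorem FQ_zero (D : ℕ) : FQ 0 D = if D = 0 then 1 else 0 := by
  ext n
  simp only [FQ, coeff_mk, colouredPairCount, Finset.univ_eq_empty, Finset.sum_empty]
  by_cases h : n = 0 ∧ D = 0
  · obtain ⟨rfl, rfl⟩ := h
    simp
  · have : IsEmpty {p : (Fin 0 → YoungDiagram) × (Fin 0 → YoungDiagram) //
        (∀ i, p.1 i ≤ p.2 i) ∧ 0 = n ∧ 0 = n + D} := ⟨fun p => h (by omega)⟩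
    rw [Nat.card_of_isEmpty]
    split_ifs with hD
    · have hn : n ≠ 0 := fun hn => h ⟨hn, hD⟩
      simp [coeff_one, hn]
    · simp

theorem FZ_zero : FZ 0 = Zq := by
  ext n
  simp only [FZ, Zq, coeff_mk, nestedPairCount, partitionCount, Nat.cast_inj]
  refine (Nat.card_eq_of_bijective (fun μ => ⟨(μ.1, μ.1), le_rfl, μ.2, μ.2⟩) ⟨?_, ?_⟩).symm
  · intro μ ν h
    simpa [Subtype.ext_iff] using h
  · rintro ⟨⟨μ, ν⟩, hle, h₁, h₂⟩
    have hle' : μ.cells ⊆ ν.cells := hle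
    have hc : ν.cells.card ≤ μ.cells.card := (h₂.trans h₁.symm).le
    obtain rfl : μ = ν := YoungDiagram.ext (Finset.eq_of_subset_of_card_le hle' hc)
    exact ⟨⟨μ, h₁⟩, rfl⟩

theorem FQ_excess_zero (r : ℕ) : FQ r 0 = Zq ^ r := by
  induction r with
  | zero => simp [FQ_zero]
  | succ r ih => simp [FQ_succ, ih, FZ_zero, pow_succ']

theorem FQ_succ_one (r : ℕ) : FQ (r + 1) 1 = ((r + 1 : ℕ) : PowerSeries ℤ) * FZ 1 * Zq ^ r := by
  have hrec (s : ℕ) : FQ (s + 1) 1 = Zq * FQ s 1 + FZ 1 * Zq ^ s := by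
    rw [FQ_succ, Finset.Nat.sum_antidiagonal_eq_sum_range_succ_mk]
    simp [Finset.sum_range_succ, FZ_zero, FQ_excess_zero]
  induction r with
  | zero => simp [hrec, FQ_zero]
  | succ r ih =>
    rw [hrec, ih]
    push_cast
    ring

theorem FQ_add_two_two (r : ℕ) :
    FQ (r + 2) 2 = ((r + 2 : ℕ) : PowerSeries ℤ) * FZ 2 * Zq ^ (r + 1) +
      ((r + 2).choose 2 : PowerSeries ℤ) * FZ 1 ^ 2 * Zq ^ r := by
  have hrec (s : ℕ) : FQ (s + 1) 2 = Zq * FQ s 2 + FZ 1 * FQ s 1 + FZ 2 * Zq ^ s := by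
    rw [FQ_succ, Finset.Nat.sum_antidiagonal_eq_sum_range_succ_mk]
    simp [Finset.sum_range_succ, FZ_zero, FQ_excess_zero]
  induction r with
  | zero =>
    rw [hrec, hrec, FQ_succ_one, FQ_zero, FQ_zero]
    simp
    ring
  | succ r ih =>
    rw [hrec, ih, FQ_succ_one, Nat.choose_succ_succ' (r + 2) 1, Nat.choose_one_right]
    push_cast
    ring

/-- `FQ_{r,1} = r·FZ₁·Z^{r−1}` for `r ≥ 1`, and
`FQ_{r,2} = r·FZ₂·Z^{r−1} + C(r,2)·FZ₁²·Z^{r−2}` for `r ≥ 2`. -/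
theorem stmt_17 :
    (∀ r : ℕ, 1 ≤ r → FQ r 1 = (r : PowerSeries ℤ) * FZ 1 * Zq ^ (r - 1)) ∧
    (∀ r : ℕ, 2 ≤ r → FQ r 2 = (r : PowerSeries ℤ) * FZ 2 * Zq ^ (r - 1) +
      (r.choose 2 : PowerSeries ℤ) * FZ 1 ^ 2 * Zq ^ (r - 2)) := by
  refine ⟨fun r hr => ?_, fun r hr => ?_⟩
  · obtain ⟨s, rfl⟩ := Nat.exists_eq_add_of_le' hr
    exact FQ_succ_one s
  · obtain ⟨s, rfl⟩ := Nat.exists_eq_add_of_le' hr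
    exact FQ_add_two_two s
end

section
/- For every integer n ≥ 4, the number of Young diagrams of size n with exactly 3 nonempty rows (equivalently, the number of partitions of n into exactly 3 parts) equals ⌊n(n−6)/12⌋ + ⌊(n−1)/2⌋ + 1, where ⌊·⌋ denotes floor division in ℤ (note n(n−6) may be negative for n = 4, 5). -/
/-- The index set of the rows of a Young diagram is an initial segment. -/
theorem YoungDiagram.image_fst_cells (μ : YoungDiagram) :
    μ.cells.image Prod.fst = Finset.range (μ.colLen 0) := by
  ext i
  simp only [Finset.mem_image, Finset.mem_range, ← YoungDiagram.mem_iff_lt_colLen]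
  constructor
  · rintro ⟨⟨i, j⟩, h, rfl⟩
    exact μ.up_left_mem le_rfl (Nat.zero_le j) h
  · intro h
    exact ⟨(i, 0), h, rfl⟩

/-- The size of a Young diagram is the sum of its row lengths. -/
theorem YoungDiagram.sum_rowLens (μ : YoungDiagram) : μ.rowLens.sum = μ.card := by
  rw [YoungDiagram.card, Finset.card_eq_sum_card_image Prod.fst, μ.image_fst_cells]
  trans ∑ i ∈ Finset.range (μ.colLen 0), μ.rowLen i
  · rw [← Multiset.sum_coe]
    rfl
  · exact Finset.sum_congr rfl fun _ _ => μ.rowLen_eq_card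

/-- The lists of positive row lengths, in weakly decreasing order, of length `k` and sum `n`. -/
def decreasingLists (n k : ℕ) : Type :=
  {w : List ℕ // (w.SortedGE ∧ ∀ x ∈ w, 0 < x) ∧ w.sum = n ∧ w.length = k}

/-- Young diagrams of size `n` with `k` rows correspond to lists of row lengths. -/
def youngDiagramEquivDecreasingLists (n k : ℕ) :
    {μ : YoungDiagram // μ.card = n ∧ (μ.cells.image Prod.fst).card = k} ≃
      decreasingLists n k where
  toFun μ := ⟨μ.1.rowLens, ⟨μ.1.rowLens_sorted, μ.1.pos_of_mem_rowLens⟩,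
    by rw [μ.1.sum_rowLens, μ.2.1],
    by simpa [μ.1.image_fst_cells] using μ.2.2⟩
  invFun w := ⟨YoungDiagram.ofRowLens w.1 w.2.1.1,
    by rw [← YoungDiagram.sum_rowLens, YoungDiagram.rowLens_ofRowLens_eq_self w.2.1.2, w.2.2.1],
    by rw [YoungDiagram.image_fst_cells, Finset.card_range, ← YoungDiagram.length_rowLens,
      YoungDiagram.rowLens_ofRowLens_eq_self w.2.1.2, w.2.2.2]⟩
  left_inv _ := Subtype.ext YoungDiagram.ofRowLens_to_rowLens_eq_self
  right_inv w := Subtype.ext (YoungDiagram.rowLens_ofRowLens_eq_self (hw := w.2.1.1) w.2.1.2)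

/-- Partitions of `n` into `k` parts correspond to their sorted lists of parts. -/
def partitionEquivDecreasingLists (n k : ℕ) :
    {P : Nat.Partition n // Multiset.card P.parts = k} ≃ decreasingLists n k where
  toFun P := ⟨P.1.parts.sort (· ≥ ·),
    ⟨(Multiset.pairwise_sort _ _).sortedGE, fun _ hx => P.1.parts_pos (by simpa using hx)⟩,
    by rw [← Multiset.sum_coe, Multiset.sort_eq, P.1.parts_sum],
    by rw [Multiset.length_sort, P.2]⟩
  invFun w := ⟨⟨w.1, fun hx => w.2.1.2 _ (by simpa using hx), by simpa using w.2.2.1⟩,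
    by simpa using w.2.2.2⟩
  left_inv P := Subtype.ext (Nat.Partition.ext (Multiset.sort_eq _ _))
  right_inv w := Subtype.ext (List.mergeSort_eq_self _ w.2.1.1.pairwise)

/-- Pairs `(b, c)` such that `(n - b - c, b, c)` is a partition of `n` into three parts. -/
def lastTwoParts (n : ℕ) : Finset (ℕ × ℕ) :=
  {p ∈ Finset.range (n + 1) ×ˢ Finset.range (n + 1) | 1 ≤ p.2 ∧ p.2 ≤ p.1 ∧ 2 * p.1 + p.2 ≤ n}

theorem mem_lastTwoParts {n b c : ℕ} :
    (b, c) ∈ lastTwoParts n ↔ 1 ≤ c ∧ c ≤ b ∧ 2 * b + c ≤ n := by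
  simp only [lastTwoParts, Finset.mem_filter, Finset.mem_product, Finset.mem_range]
  omega

theorem card_decreasingLists_three (n : ℕ) :
    Nat.card (decreasingLists n 3) = (lastTwoParts n).card := by
  rw [← Nat.card_eq_finsetCard]
  symm
  refine Nat.card_eq_of_bijective
    (fun p : lastTwoParts n => (⟨[n - p.1.1 - p.1.2, p.1.1, p.1.2], ?_⟩ : decreasingLists n 3))
    ⟨?_, ?_⟩
  · obtain ⟨⟨b, c⟩, hp⟩ := p
    rw [mem_lastTwoParts] at hp
    refine ⟨⟨List.Pairwise.sortedGE ?_, ?_⟩, ?_, rfl⟩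
    · simp
      omega
    · simp
      omega
    · simp
      omega
  · rintro ⟨⟨b, c⟩, hp⟩ ⟨⟨b', c'⟩, hp'⟩ h
    have h' := congrArg Subtype.val h
    simp only [List.cons.injEq] at h'
    simp [h'.2.1, h'.2.2.1]
  · rintro ⟨w, ⟨hs, hpos⟩, hsum, hlen⟩
    obtain ⟨a, b, c, rfl⟩ := List.length_eq_three.mp hlen
    have hp := hs.pairwise
    simp at hp hpos hsum
    refine ⟨⟨(b, c), mem_lastTwoParts.mpr (by omega)⟩, Subtype.ext ?_⟩
    simp only [List.cons.injEq, and_true]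
    omega

/-- Subtracting one from each of three parts leaves a partition into three parts unless the
smallest part is one. -/
theorem card_lastTwoParts_add_three (n : ℕ) :
    (lastTwoParts (n + 3)).card = (lastTwoParts n).card + (n + 2) / 2 := by
  have h : lastTwoParts (n + 3) =
      (lastTwoParts n).image (fun p => (p.1 + 1, p.2 + 1)) ∪
        (Finset.Icc 1 ((n + 2) / 2)).image (fun b => (b, 1)) := by
    ext ⟨b, c⟩
    simp only [Finset.mem_union, Finset.mem_image, Prod.exists, Prod.mk.injEq, mem_lastTwoParts,
      Finset.mem_Icc]
    constructor
    · intro h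
      by_cases hc : c = 1
      · exact Or.inr ⟨b, by omega, rfl, hc.symm⟩
      · exact Or.inl ⟨b - 1, c - 1, by omega, by omega, by omega⟩
    · rintro (⟨b', c', h, rfl, rfl⟩ | ⟨b', h, rfl, rfl⟩) <;> omega
  rw [h, Finset.card_union_of_disjoint, Finset.card_image_of_injective,
    Finset.card_image_of_injective, Nat.card_Icc, Nat.add_sub_cancel]
  · intro b b' hb
    simpa using hb
  · rintro ⟨b, c⟩ ⟨b', c'⟩ hb
    simpa using hb
  · rw [Finset.disjoint_left]
    rintro ⟨b, c⟩ h₁ h₂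
    simp only [Finset.mem_image, Prod.exists, Prod.mk.injEq, mem_lastTwoParts] at h₁ h₂
    obtain ⟨b', c', h, -, rfl⟩ := h₁
    obtain ⟨_, -, -, h'⟩ := h₂
    omega

theorem card_lastTwoParts (n : ℕ) :
    ((lastTwoParts n).card : ℤ) =
      (n : ℤ) * ((n : ℤ) - 6) / 12 + ((n : ℤ) - 1) / 2 + 1 := by
  induction n using Nat.strong_induction_on with
  | _ n ih =>
    by_cases hn : n < 6
    · interval_cases n <;> decide
    · obtain ⟨m, rfl⟩ := Nat.exists_eq_add_of_le' (not_lt.mp hn)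
      have h₁ : (lastTwoParts (m + 6)).card = (lastTwoParts (m + 3)).card + (m + 5) / 2 :=
        card_lastTwoParts_add_three (m + 3)
      have h₂ := card_lastTwoParts_add_three m
      have h₃ := ih m (by omega)
      have h₄ : ((m + 6 : ℕ) : ℤ) * (((m + 6 : ℕ) : ℤ) - 6) =
          (m : ℤ) * ((m : ℤ) - 6) + 12 * m := by
        push_cast
        ring
      rw [h₄]
      omega


/-- for `n ≥ 4`, the number of Young diagrams of size `n` with exactly 3
nonempty rows (equivalently, partitions of `n` into exactly 3 parts) equals
`⌊n(n−6)/12⌋ + ⌊(n−1)/2⌋ + 1`, with floor division in `ℤ`. -/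
theorem stmt_19 (n : ℕ) (hn : 4 ≤ n) :
    (Nat.card {μ : YoungDiagram // μ.card = n ∧ (μ.cells.image Prod.fst).card = 3} : ℤ) =
        Int.fdiv ((n : ℤ) * ((n : ℤ) - 6)) 12 + Int.fdiv ((n : ℤ) - 1) 2 + 1 ∧
    (Nat.card {P : Nat.Partition n // Multiset.card P.parts = 3} : ℤ) =
        Int.fdiv ((n : ℤ) * ((n : ℤ) - 6)) 12 + Int.fdiv ((n : ℤ) - 1) 2 + 1 := by
  have h : (Nat.card (decreasingLists n 3) : ℤ) =
      Int.fdiv ((n : ℤ) * ((n : ℤ) - 6)) 12 + Int.fdiv ((n : ℤ) - 1) 2 + 1 := by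
    rw [card_decreasingLists_three, card_lastTwoParts,
      Int.fdiv_eq_ediv_of_nonneg _ (by norm_num), Int.fdiv_eq_ediv_of_nonneg _ (by norm_num)]
  exact ⟨by rw [Nat.card_congr (youngDiagramEquivDecreasingLists n 3), h],
    by rw [Nat.card_congr (partitionEquivDecreasingLists n 3), h]⟩
end
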